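/- Let a group G act without inversion on locally finite pocsets P and P', let f : P → P' be a G-equivariant resolution, and let φ : P → P/∼ be an elementary fold of f. If h, k ∈ P are such that φ(h) and φ(k) are transverse in P/∼, then the classes [h]_{∼_f} and [k]_{∼_f} are transverse in P/∼_f; in particular f(h) and f(k) are transverse in P'. -/

import Mathlib

/- Pocsets, hyperplanes, admissible equivalence relations, quotients,
   admissible maps, embeddings, resolutions, group actions on pocsets,
   elementary folds and folding sequences. -/

universe u v w

/-- A pocset: a poset with an order-reversing involution `star` such that
`h ≠ h *` and `h`, `h *` are incomparable. -/
structure Pocset (P : Type u) where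
  le : P → P → Prop
  star : P → P
  le_refl : ∀ a, le a a
  le_trans : ∀ {a b c}, le a b → le b c → le a c
  le_antisymm : ∀ {a b}, le a b → le b a → a = b
  star_star : ∀ a, star (star a) = a
  star_antitone : ∀ {a b}, le a b → le (star b) (star a)
  ne_star : ∀ a, a ≠ star a
  not_le_star : ∀ a, ¬ le a (star a)
  not_star_le : ∀ a, ¬ le (star a) a

namespace Pocset

variable {P : Type u} {P' : Type v}

/-- Strict order. -/
def lt (Q : Pocset P) (a b : P) : Prop := Q.le a b ∧ a ≠ b

/-- The orientations of the hyperplane `ĥ` determined by the halfspace `h`. -/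
def orient (Q : Pocset P) (h : P) : Set P := {h, Q.star h}

/-- `k` is an orientation of the same hyperplane as `h`, i.e. `k̂ = ĥ`. -/
def sameHyp (Q : Pocset P) (h k : P) : Prop := k = h ∨ k = Q.star h

/-- The hyperplanes `ĥ` and `k̂` are transverse: they are distinct and no
orientation of `ĥ` is comparable with any orientation of `k̂`. -/
def transverse (Q : Pocset P) (h k : P) : Prop :=
  ¬ Q.sameHyp h k ∧ ∀ a ∈ Q.orient h, ∀ b ∈ Q.orient k, ¬ Q.le a b ∧ ¬ Q.le b a

/-- Two hyperplanes are disjoint if they are distinct and not transverse. -/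
def disjointHyp (Q : Pocset P) (h k : P) : Prop :=
  ¬ Q.sameHyp h k ∧ ¬ Q.transverse h k

/-- The halfspaces `h` and `k` are facing: `h* < k`. -/
def facing (Q : Pocset P) (h k : P) : Prop := Q.lt (Q.star h) k

/-- The halfspaces `h` and `k` are compatible: not `k ≤ h*`. -/
def compatible (Q : Pocset P) (h k : P) : Prop := ¬ Q.le k (Q.star h)

/-- The hyperplane `k̂` separates the hyperplanes `ĥ` and `l̂`: there are
orientations with `a < b < c`. -/
def separates (Q : Pocset P) (k h l : P) : Prop :=
  ∃ a ∈ Q.orient h, ∃ b ∈ Q.orient k, ∃ c ∈ Q.orient l, Q.lt a b ∧ Q.lt b c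

/-- Local finiteness: every interval is finite. -/
def LocallyFinite (Q : Pocset P) : Prop :=
  ∀ a b : P, {c : P | Q.le a c ∧ Q.le c b}.Finite

/-- The equivalence relation induced on hyperplanes by a relation `r` on
halfspaces: `ĥ ∼ k̂` iff `h ∼ k` or `h ∼ k*`. -/
def hypRel (Q : Pocset P) (r : P → P → Prop) (h k : P) : Prop :=
  r h k ∨ r h (Q.star k)

/-- An admissible equivalence relation on a pocset. -/
structure IsAdmissible (Q : Pocset P) (r : P → P → Prop) : Prop where
  equiv : Equivalence r
  aer1 : ∀ h, ¬ r h (Q.star h)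
  aer2 : ∀ h k, r h k → r (Q.star h) (Q.star k)
  aer3 : ∀ h k, Q.transverse h k → ¬ r h k
  aer4 : ∀ h k, Q.hypRel r h k → ¬ Q.sameHyp h k →
    (∀ m, Q.hypRel r h m → ¬ Q.separates m h k) →
    ∀ a ∈ Q.orient h, ∀ b ∈ Q.orient k, Q.facing a b → r a b

/-- The strict quotient relation: `[h] < [k]` iff `[h] ≠ [k]`, every pair of
representatives has disjoint hyperplanes, and `h' < k'` for every pair of
representatives whose hyperplanes are `([ĥ] ∪ [k̂])`-inseparable. -/
def QuotLT (Q : Pocset P) (r : P → P → Prop) (h k : P) : Prop :=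
  ¬ r h k ∧
  (∀ h' k', r h h' → r k k' → Q.disjointHyp h' k') ∧
  (∀ h' k', r h h' → r k k' →
    (∀ m, (Q.hypRel r h m ∨ Q.hypRel r k m) → ¬ Q.separates m h' k') → Q.lt h' k')

/-- The quotient relation: `[h] ≤ [k]` iff `[h] = [k]` or `[h] < [k]`. -/
def QuotLE (Q : Pocset P) (r : P → P → Prop) (h k : P) : Prop :=
  r h k ∨ Q.QuotLT r h k

/-- Transversality of `[ĥ]` and `[k̂]` in the quotient pocset. -/
def QuotTransverse (Q : Pocset P) (r : P → P → Prop) (h k : P) : Prop :=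
  ¬ Q.hypRel r h k ∧
  ∀ a ∈ Q.orient h, ∀ b ∈ Q.orient k, ¬ Q.QuotLE r a b ∧ ¬ Q.QuotLE r b a

/-- `[k̂]` separates `[ĥ]` and `[l̂]` in the quotient pocset. -/
def QuotSeparates (Q : Pocset P) (r : P → P → Prop) (k h l : P) : Prop :=
  ∃ a ∈ Q.orient h, ∃ b ∈ Q.orient k, ∃ c ∈ Q.orient l,
    Q.QuotLT r a b ∧ Q.QuotLT r b c

/-- `[h]` and `[k]` are facing in the quotient pocset: `[h]* < [k]`. -/
def QuotFacing (Q : Pocset P) (r : P → P → Prop) (h k : P) : Prop :=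
  Q.QuotLT r (Q.star h) k

/-- An admissible map of pocsets. -/
structure IsAdmissibleMap (Q : Pocset P) (Q' : Pocset P') (f : P → P') : Prop where
  am1 : ∀ h, f (Q.star h) = Q'.star (f h)
  am2 : ∀ h k, Q.transverse h k → Q'.transverse (f h) (f k)
  am3 : ∀ h k, Q.facing h k → Q'.sameHyp (f h) (f k) →
    (∀ m, Q'.sameHyp (f m) (f h) → ¬ Q.separates m h k) → f h = f k
  am4 : ∀ h' : P', (∀ m : P, ¬ Q'.sameHyp (f m) h') →
    ∃ b ∈ Q'.orient h', ∀ m : P, Q'.compatible b (f m)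

/-- An embedding of pocsets: an injective, order-reflecting admissible map. -/
structure IsPocsetEmbedding (Q : Pocset P) (Q' : Pocset P') (f : P → P') : Prop where
  adm : IsAdmissibleMap Q Q' f
  inj : Function.Injective f
  le_reflect : ∀ h k, Q'.le (f h) (f k) → Q.le h k

/-- The equivalence relation `∼_f` induced by a map `f`. -/
def simRel (f : P → P') : P → P → Prop := fun a b => f a = f b

/-- A resolution of pocsets: an admissible map `f` such that `∼_f` is an
admissible equivalence relation and the induced map `P/∼_f → P'` is an
embedding of pocsets (stated here on representatives: `quot_am2` and
`quot_am3` are admissibility of the induced map, `le_reflect` is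
order-reflection; injectivity of the induced map is automatic, and its
properties (AM1) and (AM4) coincide with those of `f`). -/
structure IsResolution (Q : Pocset P) (Q' : Pocset P') (f : P → P') : Prop where
  adm : IsAdmissibleMap Q Q' f
  aer : Q.IsAdmissible (simRel f)
  quot_am2 : ∀ h k, Q.QuotTransverse (simRel f) h k → Q'.transverse (f h) (f k)
  quot_am3 : ∀ h k, Q.QuotFacing (simRel f) h k → Q'.sameHyp (f h) (f k) →
    (∀ m, Q'.sameHyp (f m) (f h) → ¬ Q.QuotSeparates (simRel f) m h k) → f h = f k
  le_reflect : ∀ h k, Q'.le (f h) (f k) → Q.QuotLE (simRel f) h k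

/-- A group `G` acts (without inversion) on the pocset `Q` by order-preserving
bijections commuting with `star`. -/
structure IsGAction (Q : Pocset P) (G : Type w) [Group G] [MulAction G P] : Prop where
  smul_le : ∀ (g : G) (a b : P), Q.le a b → Q.le (g • a) (g • b)
  smul_star : ∀ (g : G) (a : P), g • Q.star a = Q.star (g • a)
  no_inversion : ∀ (g : G) (a : P), g • a ≠ Q.star a

/-- `G`-equivariance of a map. -/
def Equivariant (G : Type w) [Group G] [MulAction G P] [MulAction G P']
    (f : P → P') : Prop :=
  ∀ (g : G) (a : P), f (g • a) = g • f a

/-- An elementary foldable pair for a resolution `f`: facing halfspaces with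
`f h₁ = f h₂`, whose hyperplanes are `f⁻¹(f(ĥ₁))`-inseparable, such that no
pair of distinct `∼_f`-equivalent hyperplanes both separate `ĥ₁` and `ĥ₂`. -/
def ElemFoldable (Q : Pocset P) (Q' : Pocset P') (f : P → P') (h₁ h₂ : P) : Prop :=
  Q.facing h₁ h₂ ∧ f h₁ = f h₂ ∧
  (∀ m, Q'.sameHyp (f m) (f h₁) → ¬ Q.separates m h₁ h₂) ∧
  (∀ m m', Q'.sameHyp (f m) (f m') → ¬ Q.sameHyp m m' →
    ¬ (Q.separates m h₁ h₂ ∧ Q.separates m' h₁ h₂))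

/-- `r` is the smallest `G`-invariant and `star`-invariant equivalence
relation with `h₁ ∼ h₂`. -/
structure IsFoldRel (Q : Pocset P) (G : Type w) [Group G] [MulAction G P]
    (h₁ h₂ : P) (r : P → P → Prop) : Prop where
  equiv : Equivalence r
  ginv : ∀ (g : G) (a b : P), r a b → r (g • a) (g • b)
  sinv : ∀ a b, r a b → r (Q.star a) (Q.star b)
  base : r h₁ h₂
  min : ∀ s : P → P → Prop, Equivalence s →
    (∀ (g : G) (a b : P), s a b → s (g • a) (g • b)) →
    (∀ a b, s a b → s (Q.star a) (Q.star b)) → s h₁ h₂ →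
    ∀ a b, r a b → s a b

/-- `[h₁]`, `[h₂]` is an elementary foldable pair in the quotient pocset
`P/r` for the resolution induced by `f` on `P/r`. -/
def QuotElemFoldable (Q : Pocset P) (Q' : Pocset P') (f : P → P')
    (r : P → P → Prop) (h₁ h₂ : P) : Prop :=
  Q.QuotFacing r h₁ h₂ ∧ f h₁ = f h₂ ∧
  (∀ m, Q'.sameHyp (f m) (f h₁) → ¬ Q.QuotSeparates r m h₁ h₂) ∧
  (∀ m m', Q'.sameHyp (f m) (f m') → ¬ Q.hypRel r m m' →
    ¬ (Q.QuotSeparates r m h₁ h₂ ∧ Q.QuotSeparates r m' h₁ h₂))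

/-- `r'` is (the pullback to `P` of) the smallest `G`-invariant and
`star`-invariant equivalence relation on `P/r` identifying `[h₁] ∼ [h₂]`,
i.e. the smallest `G`-invariant, `star`-invariant equivalence relation on `P`
containing `r` with `h₁ ∼ h₂`. -/
structure IsFoldStepRel (Q : Pocset P) (G : Type w) [Group G] [MulAction G P]
    (r : P → P → Prop) (h₁ h₂ : P) (r' : P → P → Prop) : Prop where
  equiv : Equivalence r'
  mono : ∀ a b, r a b → r' a b
  ginv : ∀ (g : G) (a b : P), r' a b → r' (g • a) (g • b)
  sinv : ∀ a b, r' a b → r' (Q.star a) (Q.star b)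
  base : r' h₁ h₂
  min : ∀ s : P → P → Prop, Equivalence s → (∀ a b, r a b → s a b) →
    (∀ (g : G) (a b : P), s a b → s (g • a) (g • b)) →
    (∀ a b, s a b → s (Q.star a) (Q.star b)) → s h₁ h₂ →
    ∀ a b, r' a b → s a b

/-- A finite folding sequence `P = P₀ ↝ P₁ ↝ ⋯ ↝ Pₙ` for a `G`-equivariant
resolution `f : P → P'`, encoded by the sequence of equivalence relations
`rs i` on `P` with `Pᵢ = P / rs i`: `rs 0` is equality, every `rs i` refines
`∼_f`, and each step is an elementary fold (of an elementary foldable pair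
for the induced resolution `fᵢ : P/rs i → P'`). -/
def IsFoldingSequence (Q : Pocset P) (Q' : Pocset P') (G : Type w) [Group G]
    [MulAction G P] (f : P → P') (n : ℕ)
    (rs : Fin (n + 1) → (P → P → Prop)) : Prop :=
  (∀ a b : P, rs 0 a b ↔ a = b) ∧
  (∀ (i : Fin (n + 1)) (a b : P), rs i a b → f a = f b) ∧
  (∀ i : Fin n, ∃ h₁ h₂ : P,
    Q.QuotElemFoldable Q' f (rs i.castSucc) h₁ h₂ ∧
    Q.IsFoldStepRel G (rs i.castSucc) h₁ h₂ (rs i.succ))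

end Pocset

namespace Pocset

variable {P : Type u} {P' : Type v} {Q : Pocset P} {Q' : Pocset P'}

section Basic

theorem lt_trans {a b c : P} (hab : Q.lt a b) (hbc : Q.lt b c) : Q.lt a c :=
  ⟨Q.le_trans hab.1 hbc.1, fun e => hab.2 (Q.le_antisymm hab.1 (e ▸ hbc.1))⟩

theorem lt_asymm {a b : P} (hab : Q.lt a b) (hba : Q.lt b a) : False :=
  hab.2 (Q.le_antisymm hab.1 hba.1)

theorem not_lt_star {a : P} (ha : Q.lt a (Q.star a)) : False := Q.not_le_star a ha.1

theorem not_star_lt {a : P} (ha : Q.lt (Q.star a) a) : False := Q.not_star_le a ha.1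

theorem star_lt_star {a b : P} (hab : Q.lt a b) : Q.lt (Q.star b) (Q.star a) :=
  ⟨Q.star_antitone hab.1, fun e => hab.2 (by rw [← Q.star_star a, ← e, Q.star_star])⟩

theorem lt_star_comm {a b : P} (hab : Q.lt a (Q.star b)) : Q.lt b (Q.star a) := by
  simpa only [Q.star_star] using star_lt_star hab

theorem star_lt_comm {a b : P} (hab : Q.lt (Q.star a) b) : Q.lt (Q.star b) a := by
  simpa only [Q.star_star] using star_lt_star hab

theorem mem_orient {a b : P} : b ∈ Q.orient a ↔ b = a ∨ b = Q.star a := Iff.rfl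

theorem orient_star (a : P) : Q.orient (Q.star a) = Q.orient a := by
  simp only [orient, Q.star_star, Set.pair_comm]

theorem orient_eq_of_mem {a b : P} (hb : b ∈ Q.orient a) : Q.orient b = Q.orient a := by
  rcases hb with rfl | rfl
  · rfl
  · exact orient_star a

theorem sameHyp_iff_mem {a b : P} : Q.sameHyp a b ↔ b ∈ Q.orient a := Iff.rfl

theorem separates_congr {m m' a a' b b' : P} (hm : m' ∈ Q.orient m) (ha : a' ∈ Q.orient a)
    (hb : b' ∈ Q.orient b) : Q.separates m' a' b' ↔ Q.separates m a b := by
  simp only [separates, orient_eq_of_mem hm, orient_eq_of_mem ha, orient_eq_of_mem hb]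

theorem transverse_congr {a a' b b' : P} (ha : a' ∈ Q.orient a) (hb : b' ∈ Q.orient b) :
    Q.transverse a' b' ↔ Q.transverse a b := by
  have hs : Q.sameHyp a' b' ↔ Q.sameHyp a b := by
    simp only [sameHyp_iff_mem, orient_eq_of_mem ha]
    rcases hb with rfl | rfl
    · rfl
    · simp only [mem_orient]
      constructor
      · rintro (e | e)
        · right; rw [← e, Q.star_star]
        · left; rw [← Q.star_star b, e, Q.star_star]
      · rintro (e | e)
        · right; rw [e]
        · left; rw [e, Q.star_star]
  simp only [transverse, orient_eq_of_mem ha, orient_eq_of_mem hb, hs]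

theorem transverse_symm {a b : P} (hab : Q.transverse a b) : Q.transverse b a := by
  refine ⟨fun e => hab.1 ?_, fun c hc d hd => (hab.2 d hd c hc).symm⟩
  rcases e with e | e
  · exact Or.inl e.symm
  · right; rw [e, Q.star_star]

/-- The hyperplane of `y` lies in the halfspace `a`: one of its orientations is contained
in `a`. -/
def side (Q : Pocset P) (a y : P) : Prop := Q.lt y a ∨ Q.lt (Q.star y) a

theorem side_star_right {a y : P} : Q.side a (Q.star y) ↔ Q.side a y := by
  rw [side, side, Q.star_star, or_comm]

theorem side_asymm {a y : P} (h : Q.side a y) (h' : Q.side (Q.star a) y) : False := by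
  rcases h with h | h <;> rcases h' with h' | h'
  · exact not_lt_star (lt_trans h (lt_star_comm h'))
  · exact lt_asymm h (by simpa only [Q.star_star] using star_lt_star h')
  · exact lt_asymm h (lt_star_comm h')
  · exact not_star_lt (lt_trans h (by simpa only [Q.star_star] using star_lt_star h'))

theorem side_of_not_transverse {a b : P} (hab : ¬ Q.transverse a b) :
    b = a ∨ b = Q.star a ∨ Q.side a b ∨ Q.side (Q.star a) b := by
  by_contra hc
  push Not at hc
  obtain ⟨h1, h2, h3, h4⟩ := hc
  have h5 : Q.star b ≠ a := fun e => h2 (by rw [← e, Q.star_star])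
  have h6 : Q.star b ≠ Q.star a := fun e => h1 (by rw [← Q.star_star b, e, Q.star_star])
  unfold side at h3 h4
  push Not at h3 h4
  have k1 : ¬ Q.le b a := fun e => h3.1 ⟨e, h1⟩
  have k2 : ¬ Q.le (Q.star b) a := fun e => h3.2 ⟨e, h5⟩
  have k3 : ¬ Q.le b (Q.star a) := fun e => h4.1 ⟨e, h2⟩
  have k4 : ¬ Q.le (Q.star b) (Q.star a) := fun e => h4.2 ⟨e, h6⟩
  have l1 : ¬ Q.le (Q.star a) (Q.star b) := fun e => k1 (by
    simpa only [Q.star_star] using Q.star_antitone e)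
  have l2 : ¬ Q.le (Q.star a) b := fun e => k2 (by
    simpa only [Q.star_star] using Q.star_antitone e)
  have l3 : ¬ Q.le a (Q.star b) := fun e => k3 (by
    simpa only [Q.star_star] using Q.star_antitone e)
  have l4 : ¬ Q.le a b := fun e => k4 (Q.star_antitone e)
  refine hab ⟨fun e => e.elim h1 h2, ?_⟩
  rintro c (rfl | rfl) d (rfl | rfl)
  · exact ⟨l4, k1⟩
  · exact ⟨l3, k2⟩
  · exact ⟨l2, k3⟩
  · exact ⟨l1, k4⟩

theorem separates_of_side {m a b : P} (ha : Q.side m a) (hb : Q.side (Q.star m) b) :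
    Q.separates m a b := by
  have key : ∃ c ∈ Q.orient b, Q.lt m c := by
    rcases hb with hb | hb
    · exact ⟨Q.star b, Or.inr rfl, lt_star_comm hb⟩
    · exact ⟨b, Or.inl rfl, by simpa only [Q.star_star] using star_lt_star hb⟩
  obtain ⟨c, hc, hmc⟩ := key
  rcases ha with ha | ha
  · exact ⟨a, Or.inl rfl, m, Or.inl rfl, c, hc, ha, hmc⟩
  · exact ⟨_, Or.inr rfl, m, Or.inl rfl, c, hc, ha, hmc⟩

theorem separates_of_side' {m a b : P} (ha : Q.side (Q.star m) a) (hb : Q.side m b) :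
    Q.separates m a b := by
  rw [← separates_congr (m' := Q.star m) (Or.inr rfl) (Or.inl rfl) (Or.inl rfl)]
  exact separates_of_side ha (by rwa [Q.star_star])

theorem exists_side_of_separates {m a b : P} (h : Q.separates m a b) :
    ∃ n ∈ Q.orient m, Q.side n a ∧ Q.side (Q.star n) b := by
  obtain ⟨c, hc, n, hn, d, hd, hcn, hnd⟩ := h
  refine ⟨n, hn, ?_, ?_⟩
  · rcases hc with rfl | rfl
    · exact Or.inl hcn
    · exact Or.inr hcn
  · rcases hd with rfl | rfl
    · exact Or.inr (star_lt_star hnd)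
    · exact Or.inl (lt_star_comm hnd)

theorem separates_symm {m a b : P} (h : Q.separates m a b) : Q.separates m b a := by
  obtain ⟨n, hn, ha, hb⟩ := exists_side_of_separates h
  rw [← separates_congr hn (Or.inl rfl) (Or.inl rfl)]
  exact separates_of_side' hb ha

theorem not_sameHyp_of_separates {m a b : P} (h : Q.separates m a b) : ¬ Q.sameHyp m a := by
  obtain ⟨n, hn, ha, -⟩ := exists_side_of_separates h
  rw [sameHyp_iff_mem, ← orient_eq_of_mem hn]
  rintro (rfl | rfl)
  · exact ha.elim (fun e => e.2 rfl) not_star_lt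
  · rcases ha with e | e
    · exact not_star_lt e
    · rw [Q.star_star] at e
      exact e.2 rfl

/-- A halfspace separating a facing pair has an orientation lying between them. -/
theorem exists_between_of_separates {m a b : P} (hab : Q.facing a b)
    (h : Q.separates m a b) : ∃ n ∈ Q.orient m, Q.lt (Q.star a) n ∧ Q.lt n b := by
  obtain ⟨c, hc, n, hn, d, hd, hcn, hnd⟩ := h
  have hcd := lt_trans hcn hnd
  unfold facing at hab
  have hba := star_lt_comm hab
  rcases hc with rfl | rfl <;> rcases hd with rfl | rfl
  · exact (not_star_lt (lt_trans hba hcd)).elim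
  · exact (lt_asymm hba hcd).elim
  · exact ⟨n, hn, hcn, hnd⟩
  · exact (not_star_lt (lt_trans hab (by simpa only [Q.star_star] using star_lt_star hcd))).elim

end Basic

section HypRel

variable {r : P → P → Prop}

theorem hypRel_star_right {x m : P} : Q.hypRel r x (Q.star m) ↔ Q.hypRel r x m := by
  rw [hypRel, hypRel, Q.star_star, or_comm]

theorem hypRel_star_left (sinv : ∀ a b, r a b → r (Q.star a) (Q.star b)) {x m : P} :
    Q.hypRel r (Q.star x) m ↔ Q.hypRel r x m := by
  constructor
  · rintro (e | e)
    · right; simpa only [Q.star_star] using sinv _ _ e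
    · left; simpa only [Q.star_star] using sinv _ _ e
  · rintro (e | e)
    · right; exact sinv _ _ e
    · left; simpa only [Q.star_star] using sinv _ _ e

theorem hypRel_of_orient (sinv : ∀ a b, r a b → r (Q.star a) (Q.star b)) {x y m : P}
    (hy : y ∈ Q.orient x) : Q.hypRel r y m ↔ Q.hypRel r x m := by
  rcases hy with rfl | rfl
  · rfl
  · exact hypRel_star_left sinv

theorem hypRel_trans (equiv : Equivalence r) (sinv : ∀ a b, r a b → r (Q.star a) (Q.star b))
    {x y z : P} (hxy : Q.hypRel r x y) (hyz : Q.hypRel r y z) : Q.hypRel r x z := by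
  rcases hxy with e | e
  · exact hyz.imp (equiv.trans e) (equiv.trans e)
  · rw [← hypRel_star_left sinv] at hyz
    exact hyz.imp (equiv.trans e) (equiv.trans e)

theorem hypRel_symm (equiv : Equivalence r) (sinv : ∀ a b, r a b → r (Q.star a) (Q.star b))
    {x y : P} (hxy : Q.hypRel r x y) : Q.hypRel r y x := by
  rcases hxy with e | e
  · exact Or.inl (equiv.symm e)
  · right; simpa only [Q.star_star] using sinv _ _ (equiv.symm e)

end HypRel

/-- A `star`-invariant equivalence relation `r` generated by a relation `E` that identifies
disjoint inseparable halfspaces which are facing or have facing complements. -/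
structure IsFoldGenerated (Q : Pocset P) (r E : P → P → Prop) : Prop where
  equiv : Equivalence r
  sinv : ∀ a b, r a b → r (Q.star a) (Q.star b)
  not_star : ∀ a, ¬ r a (Q.star a)
  not_transverse : ∀ a b, r a b → ¬ Q.transverse a b
  gen : ∀ a b, r a b → Relation.EqvGen E a b
  sub : ∀ a b, E a b → r a b
  facing : ∀ a b, E a b → Q.lt (Q.star a) b ∨ Q.lt a (Q.star b)
  insep : ∀ a b m, E a b → Q.hypRel r a m → ¬ Q.separates m a b

namespace IsFoldGenerated

variable {r E : P → P → Prop}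

theorem side_cases (D : IsFoldGenerated Q r E) {x a b : P} (ha : Q.hypRel r x a)
    (hb : Q.hypRel r x b) : b = a ∨ b = Q.star a ∨ Q.side a b ∨ Q.side (Q.star a) b := by
  apply side_of_not_transverse
  rcases hypRel_trans D.equiv D.sinv (hypRel_symm D.equiv D.sinv ha) hb with e | e
  · exact D.not_transverse _ _ e
  · intro ht
    exact D.not_transverse _ _ e ((transverse_congr (Or.inl rfl) (Or.inr rfl)).2 ht)

/-- A property of halfspaces preserved by the generators, in both directions, is constant on
`r`-classes. -/
theorem iff_of_rel (D : IsFoldGenerated Q r E) {x : P} {p : P → Prop}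
    (step : ∀ b c, r x b → E b c → (p b ↔ p c)) {y : P} (hxy : r x y) : p x ↔ p y := by
  have key : ∀ b c, Relation.EqvGen E b c → (r x b ↔ r x c) ∧ (r x b → (p b ↔ p c)) := by
    intro b c hbc
    induction hbc with
    | rel b c h =>
      exact ⟨⟨fun e => D.equiv.trans e (D.sub _ _ h),
        fun e => D.equiv.trans e (D.equiv.symm (D.sub _ _ h))⟩, fun e => step _ _ e h⟩
    | refl _ => exact ⟨Iff.rfl, fun _ => Iff.rfl⟩
    | symm _ _ _ ih => exact ⟨ih.1.symm, fun e => (ih.2 (ih.1.2 e)).symm⟩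
    | trans _ _ _ _ _ ih ih' =>
      exact ⟨ih.1.trans ih'.1, fun e => (ih.2 e).trans (ih'.2 (ih.1.1 e))⟩
  exact (key x y (D.gen _ _ hxy)).2 (D.equiv.refl x)

/-- If no generator in the class of `y` is separated by `a`, then all hyperplanes in the class
of `y` lie on the same side of `a`. -/
theorem side_uniform (D : IsFoldGenerated Q r E) {a y : P}
    (hdis : ∀ z, r y z → Q.disjointHyp a z)
    (hins : ∀ b c, r y b → E b c → ¬ Q.separates a b c) {z : P} (hz : Q.hypRel r y z)
    (hy : Q.side a y) : Q.side a z := by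
  have key : ∀ z, r y z → Q.side a z := by
    intro z hz
    refine (D.iff_of_rel (p := Q.side a) ?_ hz).1 hy
    intro b c hb hbc
    have hc := D.equiv.trans hb (D.sub _ _ hbc)
    have dich : ∀ w, r y w → Q.side a w ∨ Q.side (Q.star a) w := by
      intro w hw
      rcases side_of_not_transverse (hdis w hw).2 with e | e | e
      · exact ((hdis w hw).1 (Or.inl e)).elim
      · exact ((hdis w hw).1 (Or.inr e)).elim
      · exact e
    have hn := hins b c hb hbc
    constructor
    · intro h
      exact (dich c hc).resolve_right fun h' => hn (separates_of_side h h')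
    · intro h
      exact (dich b hb).resolve_right fun h' => hn (separates_of_side' h' h)
  rcases hz with hz | hz
  · exact key z hz
  · exact side_star_right.1 (key _ hz)

/-- Let `K` be a nonempty set of hyperplanes lying entirely on one side of each hyperplane in the
class of `x`. If `x` and `x'` are equivalent and neither is separated from `K` by a hyperplane of
their class, then they have `K` on the same side. -/
theorem side_of_rel (D : IsFoldGenerated Q r E) {x x' : P} {K : P → Prop} (hK : ∃ y, K y)
    (huni : ∀ a, Q.hypRel r x a →
      (∀ y, K y → Q.side a y) ∨ (∀ y, K y → Q.side (Q.star a) y))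
    (hxx' : r x x')
    (hx : ∀ m, Q.hypRel r x m → (∀ y, K y → Q.side m y) → ¬ Q.side (Q.star m) x)
    (hx' : ∀ m, Q.hypRel r x m → (∀ y, K y → Q.side m y) → ¬ Q.side (Q.star m) x')
    (hside : ∀ y, K y → Q.side x y) : ∀ y, K y → Q.side x' y := by
  obtain ⟨y₀, hy₀⟩ := hK
  let p : P → Prop := fun b => ∃ a, r x a ∧
    (∀ m, Q.hypRel r x m → (∀ y, K y → Q.side m y) → ¬ Q.side (Q.star m) a) ∧
    (∀ y, K y → Q.side a y) ∧ (b = a ∨ Q.side (Q.star a) b)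
  have step : ∀ b c, r x b → r x c → (Q.lt (Q.star b) c ∨ Q.lt b (Q.star c)) →
      (∀ m, Q.hypRel r x m → ¬ Q.separates m b c) → p b → p c := by
    rintro b c hb hc hf hn ⟨a, ha, hgood, hKa, hba⟩
    rcases hba with rfl | hba
    · rcases hf with hf | hf
      · have hKc : ∀ y, K y → Q.side c y := by
          refine (huni c (Or.inl hc)).resolve_right fun h => ?_
          refine hgood (Q.star c) (hypRel_star_right.2 (Or.inl hc)) h ?_
          rw [Q.star_star]
          exact Or.inr hf
        refine ⟨c, hc, fun m hm hKm hmc => ?_, hKc, Or.inl rfl⟩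
        rcases D.side_cases hm (Or.inl hb) with e | e | e | e
        · subst e
          rcases hmc with h | h
          · exact lt_asymm h hf
          · exact not_star_lt (lt_trans h hf)
        · refine side_asymm (hKm y₀ hy₀) (e ▸ hKa y₀ hy₀)
        · exact hn m hm (separates_of_side e hmc)
        · exact hgood m hm hKm e
      · exact ⟨b, hb, hgood, hKa, Or.inr (Or.inl (lt_star_comm hf))⟩
    · refine ⟨a, ha, hgood, hKa, ?_⟩
      rcases D.side_cases (Or.inl ha) (Or.inl hc) with e | e | e | e
      · exact Or.inl e
      · exact (D.not_star a (e ▸ D.equiv.trans (D.equiv.symm ha) hc)).elim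
      · exact (hn a (Or.inl ha) (separates_of_side' hba e)).elim
      · exact Or.inr e
  have hp : p x ↔ p x' := by
    refine D.iff_of_rel (fun b c hb hbc => ?_) hxx'
    have hc := D.equiv.trans hb (D.sub _ _ hbc)
    have hn : ∀ m, Q.hypRel r x m → ¬ Q.separates m b c := fun m hm =>
      D.insep b c m hbc
        (hypRel_trans D.equiv D.sinv (hypRel_symm D.equiv D.sinv (Or.inl hb)) hm)
    have hf := D.facing _ _ hbc
    exact ⟨step b c hb hc hf hn,
      step c b hc hb (hf.imp star_lt_comm lt_star_comm)
        fun m hm hs => hn m hm (separates_symm hs)⟩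
  obtain ⟨a, ha, -, hKa, e | e⟩ := hp.1 ⟨x, D.equiv.refl x, hx, hside, Or.inl rfl⟩
  · exact e ▸ hKa
  · exact (hx' a (Or.inl ha) hKa e).elim

/-- One half of the comparison of two classes none of whose representatives are transverse: from
one inseparable pair `x`, `y` with `y` inside `x`, all inseparable pairs are on the same side. -/
theorem side_of_inseparable (D : IsFoldGenerated Q r E) {x y x' y' : P}
    (hdis : ∀ a b, Q.hypRel r x a → Q.hypRel r y b → Q.disjointHyp a b)
    (hins : ∀ a b c, Q.hypRel r x a → Q.hypRel r y b → E b c → ¬ Q.separates a b c)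
    (hx : r x x') (hy : r y y')
    (hxy : ∀ m, Q.hypRel r x m → ¬ Q.separates m x y)
    (hxy' : ∀ m, Q.hypRel r x m → ¬ Q.separates m x' y')
    (hside : Q.side x y) : Q.side x' y' := by
  have hyy : Q.hypRel r y y := Or.inl (D.equiv.refl y)
  have uni : ∀ a, Q.hypRel r x a → Q.side a y → ∀ z, Q.hypRel r y z → Q.side a z :=
    fun a ha hs z hz => D.side_uniform (fun w hw => hdis a w ha (Or.inl hw))
      (fun b c hb => hins a b c ha (Or.inl hb)) hz hs
  refine D.side_of_rel (K := Q.hypRel r y) ⟨y, hyy⟩ ?_ hx ?_ ?_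
    (uni x (Or.inl (D.equiv.refl x)) hside) y' (Or.inl hy)
  · intro a ha
    have hd := hdis a y ha hyy
    rcases side_of_not_transverse hd.2 with e | e | e | e
    · exact (hd.1 (Or.inl e)).elim
    · exact (hd.1 (Or.inr e)).elim
    · exact Or.inl (uni a ha e)
    · exact Or.inr (uni _ (hypRel_star_right.2 ha) e)
  · exact fun m hm hK hs => hxy m hm (separates_of_side' hs (hK y hyy))
  · exact fun m hm hK hs => hxy' m hm (separates_of_side' hs (hK y' (Or.inl hy)))

/-- If no representatives of the classes of `x` and `y` are transverse, no generator of one class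
is separated by the other class, and `x < y` is an inseparable pair, then `[x] < [y]`. -/
theorem quotLT (D : IsFoldGenerated Q r E) {x y : P} (hne : ¬ r x y)
    (hdis : ∀ a b, Q.hypRel r x a → Q.hypRel r y b → Q.disjointHyp a b)
    (hdis' : ∀ a b, Q.hypRel r x a → Q.hypRel r y b → Q.disjointHyp b a)
    (hins : ∀ a b c, Q.hypRel r x a → Q.hypRel r y b → E b c → ¬ Q.separates a b c)
    (hins' : ∀ a b c, Q.hypRel r y a → Q.hypRel r x b → E b c → ¬ Q.separates a b c)
    (hlt : Q.lt x y)
    (hxy : ∀ m, Q.hypRel r x m ∨ Q.hypRel r y m → ¬ Q.separates m x y) :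
    Q.QuotLT r x y := by
  refine ⟨hne, fun x' y' hx hy => hdis x' y' (Or.inl hx) (Or.inl hy), fun x' y' hx hy hn => ?_⟩
  have h₁ : Q.side y' x' := D.side_of_inseparable (fun a b ha hb => hdis' b a hb ha) hins' hy hx
    (fun m hm hs => hxy m (Or.inr hm) (separates_symm hs))
    (fun m hm hs => hn m (Or.inr hm) (separates_symm hs)) (Or.inl hlt)
  have sl : ∀ m, Q.hypRel r (Q.star x) m ↔ Q.hypRel r x m := fun m => hypRel_star_left D.sinv
  have so : ∀ {m a b}, Q.separates m (Q.star a) b ↔ Q.separates m a b := fun {m a b} =>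
    separates_congr (Or.inl rfl) (Or.inr rfl) (Or.inl rfl)
  have h₂ : Q.side (Q.star x') y' := by
    refine D.side_of_inseparable (x := Q.star x) (y := y) (fun a b ha => hdis a b ((sl a).1 ha))
      (fun a b c ha => hins a b c ((sl a).1 ha)) (D.sinv _ _ hx) hy
      (fun m hm => ?_) (fun m hm => ?_) (Or.inr (star_lt_star hlt))
    · rw [so]; exact hxy m (Or.inl ((sl m).1 hm))
    · rw [so]; exact hn m (Or.inl ((sl m).1 hm))
  rcases h₁ with h₁ | h₁
  · exact h₁
  · rcases h₂ with h₂ | h₂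
    · exact (lt_asymm h₁ h₂).elim
    · simpa only [Q.star_star] using star_lt_star h₂

end IsFoldGenerated

section QuotTransverse

variable {f : P → P'}

theorem quotTransverse_symm {r : P → P → Prop} (equiv : Equivalence r)
    (sinv : ∀ a b, r a b → r (Q.star a) (Q.star b)) {h k : P}
    (ht : Q.QuotTransverse r h k) : Q.QuotTransverse r k h :=
  ⟨fun e => ht.1 (hypRel_symm equiv sinv e), fun a ha b hb => (ht.2 b hb a ha).symm⟩

theorem quotLE_congr {r : P → P → Prop} (equiv : Equivalence r) {h h' k k' : P} (hh : r h h')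
    (hk : r k k') (hle : Q.QuotLE r h k) : Q.QuotLE r h' k' := by
  have e : ∀ {x x' : P}, r x x' → ∀ m, r x m ↔ r x' m := fun hx m =>
    ⟨equiv.trans (equiv.symm hx), equiv.trans hx⟩
  have e' : ∀ m, r m k ↔ r m k' := fun m =>
    ⟨fun x => equiv.trans x hk, fun x => equiv.trans x (equiv.symm hk)⟩
  simpa only [QuotLE, QuotLT, hypRel, e hh, e hk, e'] using hle

theorem quotTransverse_congr {r : P → P → Prop} (equiv : Equivalence r)
    (sinv : ∀ a b, r a b → r (Q.star a) (Q.star b))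
    {h h' k k' : P} (hh : Q.hypRel r h h') (hk : Q.hypRel r k k')
    (ht : Q.QuotTransverse r h' k') : Q.QuotTransverse r h k := by
  have key : ∀ {x x' : P}, Q.hypRel r x x' → ∀ a ∈ Q.orient x, ∃ a' ∈ Q.orient x', r a a' := by
    intro x x' hx a ha
    rcases ha with rfl | rfl <;> rcases hx with hx | hx
    · exact ⟨x', Or.inl rfl, hx⟩
    · exact ⟨_, Or.inr rfl, hx⟩
    · exact ⟨_, Or.inr rfl, sinv _ _ hx⟩
    · exact ⟨_, Or.inl rfl, by simpa only [Q.star_star] using sinv _ _ hx⟩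
  refine ⟨fun e => ht.1 ?_, fun a ha b hb => ?_⟩
  · exact hypRel_trans equiv sinv (hypRel_symm equiv sinv hh) (hypRel_trans equiv sinv e hk)
  · obtain ⟨a', ha', ea⟩ := key hh a ha
    obtain ⟨b', hb', eb⟩ := key hk b hb
    exact ⟨fun e => (ht.2 a' ha' b' hb').1 (quotLE_congr equiv ea eb e),
      fun e => (ht.2 a' ha' b' hb').2 (quotLE_congr equiv eb ea e)⟩

/-- Transverse halfspaces are transverse in every admissible quotient. -/
theorem IsAdmissible.quotTransverse {r : P → P → Prop} (hr : Q.IsAdmissible r) {h k : P}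
    (ht : Q.transverse h k) : Q.QuotTransverse r h k := by
  have hab : ∀ a ∈ Q.orient h, ∀ b ∈ Q.orient k, Q.transverse a b := fun a ha b hb =>
    (transverse_congr ha hb).2 ht
  refine ⟨fun e => ?_, fun a ha b hb => ⟨fun e => ?_, fun e => ?_⟩⟩
  · rcases e with e | e
    · exact hr.aer3 _ _ ht e
    · exact hr.aer3 _ _ (hab h (Or.inl rfl) _ (Or.inr rfl)) e
  · have hab := hab a ha b hb
    rcases e with e | e
    · exact hr.aer3 _ _ hab e
    · exact (e.2.1 a b (hr.equiv.refl a) (hr.equiv.refl b)).2 hab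
  · have hab := transverse_symm (hab a ha b hb)
    rcases e with e | e
    · exact hr.aer3 _ _ hab e
    · exact (e.2.1 b a (hr.equiv.refl b) (hr.equiv.refl a)).2 hab

theorem sameHyp_symm {a b : P} (h : Q.sameHyp a b) : Q.sameHyp b a := by
  rcases h with e | e
  · exact Or.inl e.symm
  · right; rw [e, Q.star_star]

theorem IsResolution.sameHyp_iff (hres : IsResolution Q Q' f) {a b : P} :
    Q'.sameHyp (f a) (f b) ↔ Q.hypRel (simRel f) a b := by
  constructor
  · intro h
    rcases sameHyp_symm h with e | e
    · exact Or.inl e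
    · right; rw [simRel, hres.adm.am1]; exact e
  · rintro (e | e)
    · exact Or.inl (Eq.symm e)
    · refine sameHyp_symm (Or.inr ?_)
      rw [← hres.adm.am1]; exact e

/-- A separator of `β` and `u` also separates `u` and `v` when `u* < β < v`. -/
theorem separates_of_between {n β u v : P} (h₁ : Q.lt (Q.star u) β) (h₂ : Q.lt β v)
    (hn : Q.separates n β u) : Q.separates n u v := by
  obtain ⟨m, hm, hl, hb⟩ := exists_between_of_separates (a := u) (b := β) h₁ (separates_symm hn)
  exact ⟨_, Or.inr rfl, m, hm, v, Or.inl rfl, hl, lt_trans hb h₂⟩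

/-- A halfspace lying between the two members of an elementary foldable pair is transverse to
their common class in `P/∼_f`. -/
theorem ElemFoldable.quotTransverse_of_between (hres : IsResolution Q Q' f) {β u v : P}
    (hfold : ElemFoldable Q Q' f u v) (h₁ : Q.lt (Q.star u) β) (h₂ : Q.lt β v) :
    Q.QuotTransverse (simRel f) β u := by
  obtain ⟨hface, huv, hsep, huniq⟩ := hfold
  have hβ : Q.separates β u v := ⟨_, Or.inr rfl, β, Or.inl rfl, v, Or.inl rfl, h₁, h₂⟩
  have hne : ¬ Q.hypRel (simRel f) β u := fun e => hsep β (hres.sameHyp_iff.2 e) hβ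
  have aux : ∀ n, Q.separates n u v →
      Q.hypRel (simRel f) β n ∨ Q.hypRel (simRel f) u n → Q.sameHyp β n := by
    rintro n hn (e | e)
    · by_contra hc
      exact huniq β n (hres.sameHyp_iff.2 e) hc ⟨hβ, hn⟩
    · exact (hsep n (sameHyp_symm (hres.sameHyp_iff.2 e)) hn).elim
  have hi₁ : ∀ n, Q.hypRel (simRel f) β n ∨ Q.hypRel (simRel f) u n → ¬ Q.separates n β u :=
    fun n hn hs => not_sameHyp_of_separates hs
      (sameHyp_symm (aux n (separates_of_between h₁ h₂ hs) hn))
  have hi₂ : ∀ n, Q.hypRel (simRel f) β n ∨ Q.hypRel (simRel f) u n → ¬ Q.separates n β v :=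
    fun n hn hs => not_sameHyp_of_separates hs (sameHyp_symm (aux n (separates_symm
      (separates_of_between (star_lt_star h₂) (star_lt_comm h₁)
        ((separates_congr (Or.inl rfl) (Or.inr rfl) (Or.inl rfl)).2 hs))) hn))
  have sinv := hres.aer.aer2
  have huv' : f (Q.star u) = f (Q.star v) := sinv _ _ huv
  have ho : ∀ {a b : P}, a ∈ Q.orient β → b ∈ Q.orient u → ∀ n,
      (Q.hypRel (simRel f) a n ∨ Q.hypRel (simRel f) b n) →
      ∀ c ∈ Q.orient u ∪ Q.orient v, ¬ Q.separates n a c := by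
    intro a b ha hb n hn c hc
    rw [hypRel_of_orient sinv ha, hypRel_of_orient sinv hb] at hn
    rcases hc with hc | hc
    · rw [separates_congr (Or.inl rfl) ha hc]; exact hi₁ n hn
    · rw [separates_congr (Or.inl rfl) ha hc]; exact hi₂ n hn
  refine ⟨hne, fun a ha b hb => ?_⟩
  obtain ⟨c, hc, hbc, hlt₁, hlt₂⟩ : ∃ c ∈ Q.orient v, f b = f c ∧
      ¬ (Q.lt a b ∧ Q.lt a c) ∧ ¬ (Q.lt b a ∧ Q.lt c a) := by
    have h₃ := star_lt_comm h₁
    have h₄ := star_lt_star h₂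
    rcases hb with rfl | rfl
    · refine ⟨v, Or.inl rfl, huv, ?_⟩
      rcases ha with rfl | rfl
      · exact ⟨fun e => not_star_lt (lt_trans h₁ e.1), fun e => lt_asymm e.2 h₂⟩
      · exact ⟨fun e => not_star_lt (lt_trans (star_lt_comm e.2) h₂),
          fun e => lt_asymm e.1 h₃⟩
    · refine ⟨Q.star v, Or.inr rfl, huv', ?_⟩
      rcases ha with rfl | rfl
      · exact ⟨fun e => lt_asymm e.1 h₁, fun e => not_star_lt (lt_trans e.2 h₂)⟩
      · exact ⟨fun e => lt_asymm e.2 h₄, fun e => not_star_lt (lt_trans e.1 h₃)⟩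
  have hab : ¬ simRel f a b := by
    intro e
    refine hne ((hypRel_of_orient sinv ha).1 ?_)
    rcases hb with rfl | rfl
    · exact Or.inl e
    · exact Or.inr e
  constructor
  · rintro (e | e)
    · exact hab e
    · exact hlt₁ ⟨e.2.2 a b rfl rfl fun n hn => ho ha hb n hn b (Or.inl hb),
        e.2.2 a c rfl hbc fun n hn => ho ha hb n hn c (Or.inr hc)⟩
  · rintro (e | e)
    · exact hab e.symm
    · exact hlt₂ ⟨e.2.2 b a rfl rfl fun n hn hs =>
          ho ha hb n hn.symm b (Or.inl hb) (separates_symm hs),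
        e.2.2 c a hbc rfl fun n hn hs => ho ha hb n hn.symm c (Or.inr hc) (separates_symm hs)⟩

theorem ElemFoldable.quotTransverse_of_separates (hres : IsResolution Q Q' f) {m u v : P}
    (hfold : ElemFoldable Q Q' f u v) (hm : Q.separates m u v) :
    Q.QuotTransverse (simRel f) m u := by
  obtain ⟨β, hβ, h₁, h₂⟩ := exists_between_of_separates hfold.1 hm
  refine quotTransverse_congr hres.aer.equiv hres.aer.aer2 ?_ (Or.inl rfl)
    (hfold.quotTransverse_of_between hres h₁ h₂)
  rcases hβ with rfl | rfl
  · exact Or.inl rfl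
  · refine Or.inr ?_
    rw [Q.star_star]
    exact rfl

end QuotTransverse

section Action

variable {G : Type w} [Group G] [MulAction G P] [MulAction G P'] {f : P → P'}

theorem IsGAction.smul_lt (hG : Q.IsGAction G) (g : G) {a b : P} (h : Q.lt a b) :
    Q.lt (g • a) (g • b) :=
  ⟨hG.smul_le g a b h.1, fun e => h.2 (smul_left_cancel g e)⟩

theorem IsGAction.smul_mem_orient (hG : Q.IsGAction G) (g : G) {a b : P} (h : b ∈ Q.orient a) :
    g • b ∈ Q.orient (g • a) := by
  rcases h with rfl | rfl
  · exact Or.inl rfl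
  · exact Or.inr (hG.smul_star g a)

theorem IsGAction.smul_separates (hG : Q.IsGAction G) (g : G) {m a b : P}
    (h : Q.separates m a b) : Q.separates (g • m) (g • a) (g • b) := by
  obtain ⟨c, hc, n, hn, d, hd, h₁, h₂⟩ := h
  exact ⟨_, hG.smul_mem_orient g hc, _, hG.smul_mem_orient g hn, _, hG.smul_mem_orient g hd,
    hG.smul_lt g h₁, hG.smul_lt g h₂⟩

theorem ElemFoldable.smul (hG : Q.IsGAction G) (hG' : Q'.IsGAction G) (hequi : Equivariant G f)
    {u v : P} (hfold : ElemFoldable Q Q' f u v) (g : G) :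
    ElemFoldable Q Q' f (g • u) (g • v) := by
  obtain ⟨hface, huv, hsep, huniq⟩ := hfold
  have hs : ∀ {m}, Q.separates m (g • u) (g • v) → Q.separates (g⁻¹ • m) u v := fun h => by
    simpa only [inv_smul_smul] using hG.smul_separates g⁻¹ h
  refine ⟨?_, ?_, fun m hm h => ?_, fun m m' hm hne h => ?_⟩
  · unfold facing
    rw [← hG.smul_star]
    exact hG.smul_lt g hface
  · rw [hequi, hequi, huv]
  · refine hsep (g⁻¹ • m) ?_ (hs h)
    rw [hequi]
    have := hG'.smul_mem_orient g⁻¹ hm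
    rwa [hequi, inv_smul_smul] at this
  · refine huniq (g⁻¹ • m) (g⁻¹ • m') ?_ (fun e => hne ?_) ⟨hs h.1, hs h.2⟩
    · rw [hequi, hequi]
      exact hG'.smul_mem_orient g⁻¹ hm
    · have := hG.smul_mem_orient g e
      rwa [smul_inv_smul, smul_inv_smul] at this

/-- The generators of the fold relation of the pair `h₁`, `h₂`: the translates of the pair and of
the complementary pair. -/
def FoldEdge (Q : Pocset P) (G : Type w) [Group G] [MulAction G P] (h₁ h₂ b c : P) : Prop :=
  ∃ g : G, (b = g • h₁ ∧ c = g • h₂) ∨ (b = Q.star (g • h₁) ∧ c = Q.star (g • h₂))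

theorem FoldEdge.smul (hG : Q.IsGAction G) {h₁ h₂ b c : P} (h : Q.FoldEdge G h₁ h₂ b c) (g : G) :
    Q.FoldEdge G h₁ h₂ (g • b) (g • c) := by
  obtain ⟨g', ⟨rfl, rfl⟩ | ⟨rfl, rfl⟩⟩ := h
  · exact ⟨g * g', Or.inl ⟨(mul_smul _ _ _).symm, (mul_smul _ _ _).symm⟩⟩
  · exact ⟨g * g', Or.inr ⟨by rw [hG.smul_star, mul_smul], by rw [hG.smul_star, mul_smul]⟩⟩

theorem FoldEdge.star {h₁ h₂ b c : P} (h : Q.FoldEdge G h₁ h₂ b c) :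
    Q.FoldEdge G h₁ h₂ (Q.star b) (Q.star c) := by
  obtain ⟨g, ⟨rfl, rfl⟩ | ⟨rfl, rfl⟩⟩ := h
  · exact ⟨g, Or.inr ⟨rfl, rfl⟩⟩
  · exact ⟨g, Or.inl ⟨Q.star_star _, Q.star_star _⟩⟩

theorem eqvGen_map {E : P → P → Prop} (φ : P → P) (hφ : ∀ b c, E b c → E (φ b) (φ c)) {a b : P}
    (h : Relation.EqvGen E a b) : Relation.EqvGen E (φ a) (φ b) := by
  induction h with
  | rel _ _ h => exact .rel _ _ (hφ _ _ h)
  | refl _ => exact .refl _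
  | symm _ _ _ ih => exact .symm _ _ ih
  | trans _ _ _ _ _ ih ih' => exact .trans _ _ _ ih ih'

variable {h₁ h₂ : P} {r : P → P → Prop}

theorem IsFoldRel.simRel (hres : IsResolution Q Q' f) (hequi : Equivariant G f)
    (hrel : Q.IsFoldRel G h₁ h₂ r) (hf : f h₁ = f h₂) (a b : P) (h : r a b) :
    Pocset.simRel f a b :=
  hrel.min (Pocset.simRel f) hres.aer.equiv
    (fun g a b e => by
      have e : f a = f b := e
      change f (g • a) = f (g • b)
      rw [hequi, hequi, e])
    hres.aer.aer2 hf a b h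

theorem FoldEdge.exists_elemFoldable (hG : Q.IsGAction G) (hG' : Q'.IsGAction G)
    (hequi : Equivariant G f) (hfold : ElemFoldable Q Q' f h₁ h₂) {b c : P}
    (h : Q.FoldEdge G h₁ h₂ b c) :
    ∃ u v, ElemFoldable Q Q' f u v ∧ u ∈ Q.orient b ∧
      (∀ m, Q.separates m b c ↔ Q.separates m u v) ∧
      (Q.lt (Q.star b) c ∨ Q.lt b (Q.star c)) := by
  obtain ⟨g, ⟨rfl, rfl⟩ | ⟨rfl, rfl⟩⟩ := h
  · have hg := hfold.smul hG hG' hequi g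
    exact ⟨_, _, hg, Or.inl rfl, fun _ => Iff.rfl, Or.inl hg.1⟩
  · have hg := hfold.smul hG hG' hequi g
    refine ⟨_, _, hg, Or.inr (Q.star_star _).symm,
      fun m => separates_congr (Or.inl rfl) (Or.inr rfl) (Or.inr rfl), Or.inr ?_⟩
    rw [Q.star_star]
    exact hg.1

theorem IsFoldRel.isFoldGenerated (hG : Q.IsGAction G) (hG' : Q'.IsGAction G)
    (hres : IsResolution Q Q' f) (hequi : Equivariant G f) (hfold : ElemFoldable Q Q' f h₁ h₂)
    (hrel : Q.IsFoldRel G h₁ h₂ r) : IsFoldGenerated Q r (Q.FoldEdge G h₁ h₂) where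
  equiv := hrel.equiv
  sinv := hrel.sinv
  not_star a e := hres.aer.aer1 a (hrel.simRel hres hequi hfold.2.1 _ _ e)
  not_transverse a b e ht := hres.aer.aer3 a b ht (hrel.simRel hres hequi hfold.2.1 _ _ e)
  gen := hrel.min _ (Relation.EqvGen.is_equivalence _)
    (fun g _ _ h => eqvGen_map (g • ·) (fun _ _ e => e.smul hG g) h)
    (fun _ _ h => eqvGen_map Q.star (fun _ _ e => e.star) h)
    (.rel _ _ ⟨1, Or.inl ⟨(one_smul G _).symm, (one_smul G _).symm⟩⟩)
  sub := by
    rintro a b ⟨g, ⟨rfl, rfl⟩ | ⟨rfl, rfl⟩⟩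
    · exact hrel.ginv g _ _ hrel.base
    · exact hrel.sinv _ _ (hrel.ginv g _ _ hrel.base)
  facing a b h := by
    obtain ⟨u, v, -, -, -, h⟩ := h.exists_elemFoldable hG hG' hequi hfold
    exact h
  insep a b m h hm hs := by
    obtain ⟨u, v, huv, hu, hsep, -⟩ := h.exists_elemFoldable hG hG' hequi hfold
    refine huv.2.2.1 m (sameHyp_symm (hres.sameHyp_iff.2 ?_)) ((hsep m).1 hs)
    rw [hypRel_of_orient hres.aer.aer2 hu]
    exact hm.imp (hrel.simRel hres hequi hfold.2.1 _ _) (hrel.simRel hres hequi hfold.2.1 _ _)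

end Action

/-- If no representatives of two distinct classes are transverse and no generator of one class is
separated by the other class, then the classes are not transverse in the quotient. -/
theorem IsFoldGenerated.not_quotTransverse {r E : P → P → Prop} (D : IsFoldGenerated Q r E)
    {h k : P}
    (hdis : ∀ a b, Q.hypRel r h a → Q.hypRel r k b → ¬ Q.transverse a b)
    (hins : ∀ a b c, Q.hypRel r h a → Q.hypRel r k b → E b c → ¬ Q.separates a b c)
    (hins' : ∀ a b c, Q.hypRel r k a → Q.hypRel r h b → E b c → ¬ Q.separates a b c) :
    ¬ Q.QuotTransverse r h k := by
  intro ht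
  have hsame : ∀ a b, Q.hypRel r h a → Q.hypRel r k b → ¬ Q.sameHyp a b := by
    rintro a b ha hb (rfl | rfl)
    · exact ht.1 (hypRel_trans D.equiv D.sinv ha (hypRel_symm D.equiv D.sinv hb))
    · exact ht.1 (hypRel_trans D.equiv D.sinv ha
        (hypRel_symm D.equiv D.sinv (hypRel_star_right.1 hb)))
  have hdj : ∀ a b, Q.hypRel r h a → Q.hypRel r k b → Q.disjointHyp a b := fun a b ha hb =>
    ⟨hsame a b ha hb, hdis a b ha hb⟩
  have hdj' : ∀ a b, Q.hypRel r h a → Q.hypRel r k b → Q.disjointHyp b a := fun a b ha hb =>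
    ⟨fun e => hsame a b ha hb (sameHyp_symm e), fun e => hdis a b ha hb (transverse_symm e)⟩
  obtain ⟨x, y, hx, hy, hxy⟩ : ∃ x y, r h x ∧ r k y ∧
      ∀ m, (Q.hypRel r h m ∨ Q.hypRel r k m) → ¬ Q.separates m x y := by
    by_contra hc
    push Not at hc
    refine (ht.2 h (Or.inl rfl) k (Or.inl rfl)).1 (Or.inr ⟨fun e => ht.1 (Or.inl e),
      fun a b ha hb => hdj a b (Or.inl ha) (Or.inl hb), fun a b ha hb hn => ?_⟩)
    obtain ⟨m, hm, hs⟩ := hc a b ha hb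
    exact (hn m hm hs).elim
  have hx' : Q.hypRel r h x := Or.inl hx
  have hy' : Q.hypRel r k y := Or.inl hy
  have ht' : Q.QuotTransverse r x y := quotTransverse_congr D.equiv D.sinv
    (hypRel_symm D.equiv D.sinv hx') (hypRel_symm D.equiv D.sinv hy') ht
  obtain ⟨a, ha, b, hb, hab⟩ : ∃ a ∈ Q.orient x, ∃ b ∈ Q.orient y, Q.lt a b := by
    rcases side_of_not_transverse (hdis x y hx' hy') with e | e | e | e
    · exact (hsame x y hx' hy' (Or.inl e)).elim
    · exact (hsame x y hx' hy' (Or.inr e)).elim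
    · rcases e with e | e
      · exact ⟨_, Or.inr rfl, _, Or.inr rfl, star_lt_star e⟩
      · exact ⟨_, Or.inr rfl, y, Or.inl rfl, star_lt_comm e⟩
    · rcases e with e | e
      · exact ⟨x, Or.inl rfl, _, Or.inr rfl, lt_star_comm e⟩
      · exact ⟨x, Or.inl rfl, y, Or.inl rfl, by
          simpa only [Q.star_star] using star_lt_star e⟩
  have hac : ∀ m, Q.hypRel r a m ↔ Q.hypRel r h m := fun m =>
    (hypRel_of_orient D.sinv ha).trans ⟨hypRel_trans D.equiv D.sinv hx',
      hypRel_trans D.equiv D.sinv (hypRel_symm D.equiv D.sinv hx')⟩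
  have hbc : ∀ m, Q.hypRel r b m ↔ Q.hypRel r k m := fun m =>
    (hypRel_of_orient D.sinv hb).trans ⟨hypRel_trans D.equiv D.sinv hy',
      hypRel_trans D.equiv D.sinv (hypRel_symm D.equiv D.sinv hy')⟩
  have hnot := (ht'.2 a ha b hb).1
  refine hnot (Or.inr (D.quotLT (fun e => hnot (Or.inl e)) ?_ ?_ ?_ ?_ hab ?_))
  · simpa only [hac, hbc] using hdj
  · simpa only [hac, hbc] using hdj'
  · simpa only [hac, hbc] using hins
  · simpa only [hac, hbc] using hins'
  · intro m hm
    rw [hac, hbc] at hm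
    rw [separates_congr (Or.inl rfl) ha hb]
    exact hxy m hm

end Pocset

/-- if the images of `h` and `k` under an elementary fold `φ`
of a resolution `f` are transverse, then `[h]` and `[k]` are transverse in
`P/∼_f`; in particular `f h` and `f k` are transverse in `P'`. -/
theorem no_more_crossing {P : Type u} {P' : Type v}
    (Q : Pocset P) (Q' : Pocset P')
    (hLF : Q.LocallyFinite) (hLF' : Q'.LocallyFinite)
    (G : Type w) [Group G] [MulAction G P] [MulAction G P']
    (hG : Q.IsGAction G) (hG' : Q'.IsGAction G)
    (f : P → P') (hres : Pocset.IsResolution Q Q' f)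
    (hequi : Pocset.Equivariant G f)
    (h₁ h₂ : P) (hfold : Pocset.ElemFoldable Q Q' f h₁ h₂)
    (r : P → P → Prop) (hrel : Q.IsFoldRel G h₁ h₂ r)
    (h k : P) (ht : Q.QuotTransverse r h k) :
    Q.QuotTransverse (Pocset.simRel f) h k ∧ Q'.transverse (f h) (f k) := by
  have equiv := hres.aer.equiv
  have sinv := hres.aer.aer2
  suffices hs : Q.QuotTransverse (Pocset.simRel f) h k from ⟨hs, hres.quot_am2 h k hs⟩
  by_contra hnot
  have hsub : ∀ {x m}, Q.hypRel r x m → Q.hypRel (Pocset.simRel f) x m := fun hm =>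
    hm.imp (hrel.simRel hres hequi hfold.2.1 _ _) (hrel.simRel hres hequi hfold.2.1 _ _)
  have hsep : ∀ {x y a b c}, Q.hypRel r x a → Q.hypRel r y b → Q.FoldEdge G h₁ h₂ b c →
      Q.separates a b c → Q.QuotTransverse (Pocset.simRel f) x y := by
    intro x y a b c ha hb hbc hs
    obtain ⟨u, v, huv, hu, hsuv, -⟩ := hbc.exists_elemFoldable hG hG' hequi hfold
    refine Pocset.quotTransverse_congr equiv sinv (hsub ha) ?_
      (huv.quotTransverse_of_separates hres ((hsuv a).1 hs))
    rcases hu with rfl | rfl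
    · exact hsub hb
    · exact Pocset.hypRel_star_right.2 (hsub hb)
  refine (hrel.isFoldGenerated hG hG' hres hequi hfold).not_quotTransverse
    (fun a b ha hb hab => hnot ?_) (fun a b c ha hb hbc hs => hnot (hsep ha hb hbc hs))
    (fun a b c ha hb hbc hs =>
      hnot (Pocset.quotTransverse_symm equiv sinv (hsep ha hb hbc hs))) ht
  exact Pocset.quotTransverse_congr equiv sinv (hsub ha) (hsub hb) (hres.aer.quotTransverse hab)
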